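/- Let A : 𝒦 →L[ℂ] ℋ and B : 𝒦 →L[ℂ] ℋ be bounded operators between complex Hilbert spaces such that A B* = 0 and B A* = 0. Then ‖A* B + B* A‖ = ‖A* B‖. -/

import Mathlib

open ContinuousLinearMap

/-- The symmetrization of a square-zero element of a C⋆-algebra has the same norm as the element. -/
theorem norm_add_star_of_mul_self_eq_zero {R : Type*} [NonUnitalCStarAlgebra R] {x : R}
    (hx : x * x = 0) : ‖x + star x‖ = ‖x‖ := by
  have hsx : star x * star x = 0 := by rw [← star_mul, hx, star_zero]
  have hprod : (x * star x) * (star x * x) = 0 := by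
    rw [mul_assoc, ← mul_assoc (star x), hsx, zero_mul, mul_zero]
  have hsq : star (x + star x) * (x + star x) = x * star x + star x * x := by
    simp only [star_add, star_star, mul_add, add_mul, hx, hsx, zero_add, add_comm]
  have hnorm : ‖x + star x‖ * ‖x + star x‖ = ‖x‖ * ‖x‖ := by
    rw [← CStarRing.norm_star_mul_self, hsq,
      (IsSelfAdjoint.mul_star_self x).norm_add_eq_max (.star_mul_self x) hprod,
      CStarRing.norm_self_mul_star, CStarRing.norm_star_mul_self, max_self]
  exact (mul_self_inj (norm_nonneg _) (norm_nonneg _)).mp hnorm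

/-- If `A B* = 0` and `B A* = 0`, then `‖A* B + B* A‖ = ‖A* B‖`. -/
theorem norm_symmetrized_offdiagonal {𝒦 ℋ : Type*}
    [NormedAddCommGroup 𝒦] [InnerProductSpace ℂ 𝒦] [CompleteSpace 𝒦]
    [NormedAddCommGroup ℋ] [InnerProductSpace ℂ ℋ] [CompleteSpace ℋ]
    (A B : 𝒦 →L[ℂ] ℋ)
    (hAB : A ∘L adjoint B = 0) (hBA : B ∘L adjoint A = 0) :
    ‖adjoint A ∘L B + adjoint B ∘L A‖ = ‖adjoint A ∘L B‖ := by
  have hsq : (adjoint A ∘L B) * (adjoint A ∘L B) = 0 := by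
    ext v
    simpa using congrArg (adjoint A) (DFunLike.congr_fun hBA (B v))
  have hstar : star (adjoint A ∘L B) = adjoint B ∘L A := by
    rw [star_eq_adjoint, adjoint_comp, adjoint_adjoint]
  rw [← hstar]
  exact norm_add_star_of_mul_self_eq_zero hsq
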